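/- Let X be a nonempty set, let Φ be a mapping with domain X², and let a₀ ∈ Φ(X²). Then the following statements are equivalent: (1) Φ is a₀-coherent; (2) the subsemigroup B_X(P_{Φ⁻¹}) of the semigroup of binary relations on X generated by the set of fibers P_{Φ⁻¹} is a monoid, and the fiber Φ⁻¹(a₀) is the identity element of this monoid. -/

import Mathlib

open Set

universe u v w z

def range2 {X : Type u} {A : Type w} (Φ : X → X → A) : Set A := {a | ∃ x y, Φ x y = a}

def fiber {X : Type u} {A : Type w} (Φ : X → X → A) (a : A) : Set (X × X) :=
  {p | Φ p.1 p.2 = a}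

def fibers {X : Type u} {A : Type w} (Φ : X → X → A) : Set (Set (X × X)) :=
  {R | ∃ a ∈ range2 Φ, R = fiber Φ a}

def IsCoherent {X : Type u} {A : Type w} (Φ : X → X → A) (a₀ : A) : Prop :=
  Equivalence (fun x y => Φ x y = a₀) ∧
    ∀ x₁ x₂ x₃ x₄, Φ x₁ x₂ = a₀ → Φ x₃ x₄ = a₀ → Φ x₁ x₃ = Φ x₂ x₄

def CombSim {X : Type u} {Y : Type v} {A : Type w} {B : Type z}
    (Φ : X → X → A) (Ψ : Y → Y → B) : Prop :=
  ∃ (g : Y → X) (f : A → B), Function.Bijective g ∧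
    Set.BijOn f (range2 Φ) (range2 Ψ) ∧ ∀ x y, Ψ x y = f (Φ (g x) (g y))

def IsPseudometric {X : Type u} (d : X → X → ℝ) : Prop :=
  (∀ x y, 0 ≤ d x y) ∧ (∀ x y, d x y = d y x) ∧ (∀ x, d x x = 0) ∧
    ∀ x y z, d x y ≤ d x z + d z y

noncomputable instance relSemigroup {X : Type u} : Semigroup (Set (X × X)) where
  mul R T := {p : X × X | ∃ zz, (p.1, zz) ∈ R ∧ (zz, p.2) ∈ T}
  mul_assoc R S T := by
    ext p
    constructor
    · rintro ⟨a, ⟨b, h1, h2⟩, h3⟩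
      exact ⟨b, h1, a, h2, h3⟩
    · rintro ⟨b, h1, a, h2, h3⟩
      exact ⟨a, ⟨b, h1, h2⟩, h3⟩

theorem mem_rel_mul {X : Type u} {R T : Set (X × X)} {x y : X} :
    (x, y) ∈ R * T ↔ ∃ z, (x, z) ∈ R ∧ (z, y) ∈ T :=
  Iff.rfl

theorem fiber_mem_closure {X : Type u} {A : Type w} (Φ : X → X → A) {a : A}
    (ha : a ∈ range2 Φ) : fiber Φ a ∈ Subsemigroup.closure (fibers Φ) :=
  Subsemigroup.subset_closure ⟨a, ha, rfl⟩

theorem IsCoherent.fiber_mul_fiber {X : Type u} {A : Type w} {Φ : X → X → A} {a₀ : A}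
    (h : IsCoherent Φ a₀) (a : A) : fiber Φ a₀ * fiber Φ a = fiber Φ a := by
  ext ⟨x, y⟩
  rw [mem_rel_mul]
  constructor
  · rintro ⟨z, hxz, hzy⟩
    exact (h.2 x z y y hxz (h.1.refl y)).trans hzy
  · exact fun hxy => ⟨x, h.1.refl x, hxy⟩

theorem IsCoherent.fiber_mul_fiber_right {X : Type u} {A : Type w} {Φ : X → X → A} {a₀ : A}
    (h : IsCoherent Φ a₀) (a : A) : fiber Φ a * fiber Φ a₀ = fiber Φ a := by
  ext ⟨x, y⟩
  rw [mem_rel_mul]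
  constructor
  · rintro ⟨z, hxz, hzy⟩
    exact (h.2 x x z y (h.1.refl x) hzy).symm.trans hxz
  · exact fun hxy => ⟨y, hxy, h.1.refl y⟩

theorem isCoherent_of_fiber_mul {X : Type u} {A : Type w} {Φ : X → X → A} {a₀ : A}
    (hl : ∀ a ∈ range2 Φ, fiber Φ a₀ * fiber Φ a = fiber Φ a)
    (hr : ∀ a ∈ range2 Φ, fiber Φ a * fiber Φ a₀ = fiber Φ a) : IsCoherent Φ a₀ := by
  have left_eq : ∀ x z y, Φ x z = a₀ → Φ x y = Φ z y := fun x z y hxz => by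
    have hmem : (x, y) ∈ fiber Φ a₀ * fiber Φ (Φ z y) := ⟨z, hxz, rfl⟩
    rwa [hl _ ⟨z, y, rfl⟩] at hmem
  have right_eq : ∀ x z y, Φ z y = a₀ → Φ x y = Φ x z := fun x z y hzy => by
    have hmem : (x, y) ∈ fiber Φ (Φ x z) * fiber Φ a₀ := ⟨z, rfl, hzy⟩
    rwa [hr _ ⟨x, z, rfl⟩] at hmem
  have refl : ∀ x, Φ x x = a₀ := fun x => by
    have hmem : (x, x) ∈ fiber Φ (Φ x x) := rfl
    rw [← hl _ ⟨x, x, rfl⟩] at hmem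
    obtain ⟨z, hxz, -⟩ := hmem
    exact (right_eq x x z hxz).symm.trans hxz
  refine ⟨⟨refl, fun {x y} hxy => ?_, fun {x y z} hxy hyz => ?_⟩, fun x₁ x₂ x₃ x₄ h₁₂ h₃₄ => ?_⟩
  · exact (left_eq x y x hxy).symm.trans (refl x)
  · exact (left_eq x y z hxy).trans hyz
  · exact (left_eq x₁ x₂ x₃ h₁₂).trans (right_eq x₂ x₃ x₄ h₃₄).symm

/-- Theorem 2.7: `Φ` is `a₀`-coherent iff the subsemigroup of binary relations on `X`
generated by the fibers of `Φ` is a monoid with identity element `Φ⁻¹(a₀)`. -/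
theorem coherent_iff_monoid_with_identity_fiber {X : Type u} {A : Type w} [Nonempty X]
    (Φ : X → X → A) (a₀ : A) (ha₀ : a₀ ∈ range2 Φ) :
    IsCoherent Φ a₀ ↔
      (fiber Φ a₀ ∈ Subsemigroup.closure (fibers Φ) ∧
        ∀ R ∈ Subsemigroup.closure (fibers Φ),
          fiber Φ a₀ * R = R ∧ R * fiber Φ a₀ = R) := by
  constructor
  · intro h
    refine ⟨fiber_mem_closure Φ ha₀, fun R hR => ?_⟩
    induction hR using Subsemigroup.closure_induction with
    | mem R hR =>
      obtain ⟨a, -, rfl⟩ := hR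
      exact ⟨h.fiber_mul_fiber a, h.fiber_mul_fiber_right a⟩
    | mul R T _ _ hR hT =>
      exact ⟨by rw [← mul_assoc, hR.1], by rw [mul_assoc, hT.2]⟩
  · rintro ⟨-, h⟩
    exact isCoherent_of_fiber_mul (fun a ha => (h _ (fiber_mem_closure Φ ha)).1)
      fun a ha => (h _ (fiber_mem_closure Φ ha)).2
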